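/- arXiv:2302.06309 — 3 statements merged into one kernel-verified Lean document; each statement's English description precedes it below -/
import Mathlib

section
/- Let $\Phi$ denote the standard Gaussian CDF and $\Phi_\rho$ the CDF of a $\rho$-correlated bivariate standard Gaussian. Fix $\rho \in [0,1)$ and $u, v \in \mathbb{R}$, and set $\kappa = 2 + (1-\rho^2)^{-1/2}\max\{0, -\max\{u,v\}\}$. Then $\Phi_\rho(u,v) \le \Phi(u + \kappa\rho)\,\Phi(v + \kappa\rho)$. -/
open MeasureTheory ProbabilityTheory

/-- The standard Gaussian CDF. -/
noncomputable def Phi (u : ℝ) : ℝ := ((gaussianReal 0 1) (Set.Iic u)).toReal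

/-- The CDF of a ρ-correlated bivariate standard Gaussian vector:
`Φ_ρ(u,v) = P[Z ≤ u, ρZ + √(1-ρ²) Z' ≤ v]` for independent standard Gaussians `Z, Z'`. -/
noncomputable def Phi2 (ρ u v : ℝ) : ℝ :=
  (((gaussianReal 0 1).prod (gaussianReal 0 1))
    {p : ℝ × ℝ | p.1 ≤ u ∧ ρ * p.1 + Real.sqrt (1 - ρ ^ 2) * p.2 ≤ v}).toReal

open Filter Set Topology

/-- The standard Gaussian density. -/
noncomputable def stdPDF (x : ℝ) : ℝ := (√(2 * Real.pi))⁻¹ * Real.exp (-x ^ 2 / 2)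

lemma gaussianPDFReal_zero_one : gaussianPDFReal 0 1 = stdPDF := by
  ext x
  simp [gaussianPDFReal_def, stdPDF]

lemma stdPDF_pos (x : ℝ) : 0 < stdPDF x := by
  unfold stdPDF; positivity

lemma stdPDF_le_one (x : ℝ) : stdPDF x ≤ 1 := by
  have h1 : (√(2 * Real.pi))⁻¹ ≤ 1 := by
    apply inv_le_one_of_one_le₀
    rw [Real.one_le_sqrt]
    linarith [Real.pi_gt_three]
  have h2 : Real.exp (-x ^ 2 / 2) ≤ 1 := Real.exp_le_one_iff.2 (by nlinarith [sq_nonneg x])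
  exact mul_le_one₀ h1 (Real.exp_pos _).le h2

lemma continuous_stdPDF : Continuous stdPDF := by
  unfold stdPDF; fun_prop

lemma hasDerivAt_stdPDF (x : ℝ) : HasDerivAt stdPDF (-x * stdPDF x) x := by
  have h := ((((hasDerivAt_id x).pow 2).neg.div_const 2).exp).const_mul (√(2 * Real.pi))⁻¹
  refine h.congr_deriv ?_
  simp [stdPDF]
  ring

lemma stdPDF_mul_eq {x y x' y' : ℝ} (h : x ^ 2 + y ^ 2 = x' ^ 2 + y' ^ 2) :
    stdPDF x * stdPDF y = stdPDF x' * stdPDF y' := by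
  have key : ∀ a b : ℝ, stdPDF a * stdPDF b =
      (√(2 * Real.pi))⁻¹ ^ 2 * Real.exp (-(a ^ 2 + b ^ 2) / 2) := fun a b => by
    have : -(a ^ 2 + b ^ 2) / 2 = -a ^ 2 / 2 + -b ^ 2 / 2 := by ring
    rw [this, Real.exp_add]
    unfold stdPDF
    ring
  rw [key, key, h]

lemma stdPDF_le_stdPDF {x y : ℝ} (h : y ^ 2 ≤ x ^ 2) : stdPDF x ≤ stdPDF y := by
  unfold stdPDF; gcongr

lemma tendsto_stdPDF_atBot : Tendsto stdPDF atBot (𝓝 0) := by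
  have h : Tendsto (fun x : ℝ => -x ^ 2 / 2) atBot atBot := by
    have h2 : Tendsto (fun x : ℝ => x ^ 2) atBot atTop := by
      simpa [sq] using (tendsto_id (α := ℝ) (x := atBot)).atBot_mul_atBot₀ tendsto_id
    exact (tendsto_neg_atTop_atBot.comp h2).atBot_div_const two_pos
  have := (Real.tendsto_exp_atBot.comp h).const_mul (√(2 * Real.pi))⁻¹
  rw [mul_zero] at this
  exact this

lemma Phi_eq_cdf : Phi = cdf (gaussianReal 0 1) := by
  ext x
  rw [cdf_eq_real]; rfl

lemma Phi_nonneg (x : ℝ) : 0 ≤ Phi x := ENNReal.toReal_nonneg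

lemma Phi_le_one (x : ℝ) : Phi x ≤ 1 := by
  rw [Phi_eq_cdf]; exact cdf_le_one _ _

lemma Phi_mono : Monotone Phi := by
  rw [Phi_eq_cdf]; exact monotone_cdf _

lemma tendsto_Phi_atBot : Tendsto Phi atBot (𝓝 0) := by
  rw [Phi_eq_cdf]; exact tendsto_cdf_atBot _

lemma tendsto_Phi_atTop : Tendsto Phi atTop (𝓝 1) := by
  rw [Phi_eq_cdf]; exact tendsto_cdf_atTop _

lemma integrable_stdPDF : Integrable stdPDF := by
  rw [← gaussianPDFReal_zero_one]; exact integrable_gaussianPDFReal 0 1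

lemma Phi_eq_integral (x : ℝ) : Phi x = ∫ y in Iic x, stdPDF y := by
  rw [Phi, gaussianReal_apply_eq_integral 0 one_ne_zero, gaussianPDFReal_zero_one,
    ENNReal.toReal_ofReal]
  exact integral_nonneg fun y => (stdPDF_pos y).le

lemma hasDerivAt_Phi (x : ℝ) : HasDerivAt Phi (stdPDF x) x := by
  have h : Phi = fun y => (∫ t in (0 : ℝ)..y, stdPDF t) + Phi 0 := by
    ext y
    rw [Phi_eq_integral, Phi_eq_integral,
      ← intervalIntegral.integral_Iic_sub_Iic integrable_stdPDF.integrableOn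
        integrable_stdPDF.integrableOn]
    ring
  rw [h]
  exact (intervalIntegral.integral_hasDerivAt_right (continuous_stdPDF.intervalIntegrable _ _)
    continuous_stdPDF.stronglyMeasurable.stronglyMeasurableAtFilter
    continuous_stdPDF.continuousAt).add_const _

lemma continuous_Phi : Continuous Phi :=
  continuous_iff_continuousAt.2 fun x => (hasDerivAt_Phi x).continuousAt

lemma Phi_add_Phi_neg (x : ℝ) : Phi x + Phi (-x) = 1 := by
  have hd : ∀ y, HasDerivAt (fun y => Phi y + Phi (-y)) 0 y := fun y => by
    have h := (hasDerivAt_Phi y).add ((hasDerivAt_Phi (-y)).comp y (hasDerivAt_neg y))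
    refine h.congr_deriv ?_
    simp [stdPDF]
  have hc : ∀ y, Phi y + Phi (-y) = Phi x + Phi (-x) := fun y =>
    is_const_of_deriv_eq_zero (fun z => (hd z).differentiableAt) (fun z => (hd z).deriv) y x
  have ht : Tendsto (fun y => Phi y + Phi (-y)) atTop (𝓝 (1 + 0)) :=
    tendsto_Phi_atTop.add (tendsto_Phi_atBot.comp tendsto_neg_atTop_atBot)
  simp only [hc, add_zero] at ht
  exact tendsto_nhds_unique tendsto_const_nhds ht

lemma Phi_zero : Phi 0 = 1 / 2 := by
  have h := Phi_add_Phi_neg 0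
  rw [neg_zero] at h
  linarith

/-- A function that tends to `0` at `-∞` and has nonnegative derivative on `(-∞, b]` is nonnegative
there. -/
lemma nonneg_of_tendsto_atBot_of_deriv_nonneg {f f' : ℝ → ℝ} {b : ℝ}
    (hd : ∀ x ≤ b, HasDerivAt f (f' x) x) (hf' : ∀ x ≤ b, 0 ≤ f' x)
    (ht : Tendsto f atBot (𝓝 0)) {x : ℝ} (hx : x ≤ b) : 0 ≤ f x := by
  have hm : MonotoneOn f (Iic b) := by
    refine monotoneOn_of_hasDerivWithinAt_nonneg (f' := f') (convex_Iic b)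
      (fun y hy => (hd y hy).continuousAt.continuousWithinAt)
      (fun y hy => (hd y (interior_subset (s := Iic b) hy)).hasDerivWithinAt)
      (fun y hy => hf' y (interior_subset (s := Iic b) hy))
  refine le_of_tendsto ht ?_
  filter_upwards [eventually_le_atBot x] with y hy
  exact hm (hy.trans hx) hx hy

/-- Inverse Mill's ratio bound. -/
lemma stdPDF_le_mul_Phi (s : ℝ) : stdPDF s ≤ (1 + max 0 (-s)) * Phi s := by
  have hneg : ∀ x : ℝ, x ≤ 0 → stdPDF x ≤ (1 - x) * Phi x := fun x hx => by
    have hd : ∀ y : ℝ, y ≤ 0 → HasDerivAt (fun y => Phi y - stdPDF y / (1 - y))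
        (stdPDF y * (-y / (1 - y) ^ 2)) y := fun y hy => by
      have hy' : (1 - y) ≠ 0 := by linarith
      have h := (hasDerivAt_Phi y).sub
        ((hasDerivAt_stdPDF y).div ((hasDerivAt_id y).const_sub 1) hy')
      refine h.congr_deriv ?_
      simp only [id]
      field_simp
      ring
    have ht : Tendsto (fun y => Phi y - stdPDF y / (1 - y)) atBot (𝓝 0) := by
      have h1 : Tendsto (fun y : ℝ => 1 - y) atBot atTop :=
        tendsto_atTop_add_const_left _ 1 tendsto_neg_atBot_atTop
      have h := tendsto_Phi_atBot.sub (tendsto_stdPDF_atBot.mul h1.inv_tendsto_atTop)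
      simpa [div_eq_mul_inv] using h
    have h := nonneg_of_tendsto_atBot_of_deriv_nonneg hd (fun y hy => by
      have := (stdPDF_pos y).le
      have h0 : 0 ≤ -y := by linarith
      positivity) ht hx
    have hx' : 0 < 1 - x := by linarith
    rw [sub_nonneg, div_le_iff₀ hx'] at h
    linarith
  rcases le_total s 0 with hs | hs
  · rw [max_eq_right (by linarith)]
    linarith [hneg s hs]
  · rw [max_eq_left (by linarith)]
    have h1 := hneg 0 le_rfl
    have h2 : stdPDF s ≤ stdPDF 0 := stdPDF_le_stdPDF (by nlinarith)
    have h3 := Phi_mono hs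
    linarith

lemma Phi_sub_le {v d : ℝ} (hv : v ≤ 0) (hd : 0 ≤ d) :
    Phi (v - d) ≤ Real.exp (-d ^ 2 / 2) * Phi v := by
  have hder : ∀ x ≤ (0 : ℝ), HasDerivAt (fun x => Real.exp (-d ^ 2 / 2) * Phi x - Phi (x - d))
      (Real.exp (-d ^ 2 / 2) * stdPDF x - stdPDF (x - d)) x := fun x _ => by
    have h := ((hasDerivAt_Phi x).const_mul (Real.exp (-d ^ 2 / 2))).sub
      ((hasDerivAt_Phi (x - d)).comp x ((hasDerivAt_id x).sub_const d))
    exact h.congr_deriv (by simp)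
  have ht : Tendsto (fun x => Real.exp (-d ^ 2 / 2) * Phi x - Phi (x - d)) atBot (𝓝 0) := by
    have h := (tendsto_Phi_atBot.const_mul (Real.exp (-d ^ 2 / 2))).sub
      (tendsto_Phi_atBot.comp (tendsto_atBot_add_const_right _ (-d) tendsto_id))
    simpa [Function.comp_def, sub_eq_add_neg] using h
  have h := nonneg_of_tendsto_atBot_of_deriv_nonneg hder (fun x hx => by
    have h1 : stdPDF (x - d) = Real.exp (-d ^ 2 / 2) * stdPDF x * Real.exp (x * d) := by
      have : -(x - d) ^ 2 / 2 = -d ^ 2 / 2 + -x ^ 2 / 2 + x * d := by ring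
      unfold stdPDF
      rw [this, Real.exp_add, Real.exp_add]
      ring
    have h2 : Real.exp (x * d) ≤ 1 := Real.exp_le_one_iff.2 (by nlinarith)
    have h3 : 0 ≤ Real.exp (-d ^ 2 / 2) * stdPDF x :=
      mul_nonneg (Real.exp_pos _).le (stdPDF_pos x).le
    rw [h1]
    nlinarith) ht hv
  linarith

/-- `exp (-t) ≤ 1 / (1 + t + t ^ 2 / 2)`, in product form. -/
lemma exp_neg_le_of_one_le {t c : ℝ} (ht : 0 ≤ t) (hc : 1 ≤ c * (1 + t + t ^ 2 / 2)) :
    Real.exp (-t) ≤ c := by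
  have h := Real.quadratic_le_exp_of_nonneg ht
  have hc0 : 0 ≤ c := by
    by_contra hneg
    push Not at hneg
    nlinarith [sq_nonneg t, mul_pos_of_neg_of_neg hneg hneg,
      mul_nonneg (neg_nonneg.2 hneg.le) (by positivity : 0 ≤ 1 + t + t ^ 2 / 2)]
  rw [Real.exp_neg, inv_le_iff_one_le_mul₀ (Real.exp_pos _)]
  nlinarith

/-- For a shift of at least `√3` the smaller marginal is already below the product. -/
lemma Phi_le_Phi_mul_Phi {u v d e : ℝ} (hvu : v ≤ u) (hd : 3 ≤ d ^ 2) (hd0 : 0 ≤ d)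
    (hde : d ≤ e) (hue : d ≤ u + e) : Phi v ≤ Phi (u + e) * Phi (v + e) := by
  have hexp : Real.exp (-d ^ 2 / 2) ≤ 2 / 7 := by
    rw [neg_div]
    exact exp_neg_le_of_one_le (by positivity) (by nlinarith)
  have htail : ∀ x : ℝ, 0 ≤ x → 1 - Phi (x + d) ≤ 2 / 7 * (1 - Phi x) := fun x hx => by
    have h := Phi_sub_le (neg_nonpos.2 hx) hd0
    have h1 := Phi_add_Phi_neg x
    have h2 := Phi_add_Phi_neg (x + d)
    rw [show -(x + d) = -x - d by ring] at h2
    nlinarith [Phi_nonneg (-x)]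
  have hdPhi : 6 / 7 ≤ Phi d := by
    have h := htail 0 le_rfl
    rw [zero_add, Phi_zero] at h
    linarith
  have hvd : Phi (v + d) ≤ Phi (v + e) := Phi_mono (by linarith)
  rcases le_total 0 v with hv | hv
  · have h1 : Phi (v + d) ≤ Phi (u + e) := Phi_mono (by linarith)
    have h2 := htail v hv
    have h3 := Phi_nonneg (v + d)
    have h4 : Phi (v + d) * Phi (v + d) ≤ Phi (u + e) * Phi (v + e) := by gcongr; exact Phi_nonneg _
    nlinarith [Phi_le_one v, Phi_nonneg v, sq_nonneg (1 - Phi (v + d))]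
  · have hue' : 6 / 7 ≤ Phi (u + e) := hdPhi.trans (Phi_mono hue)
    have h4 : 6 / 7 * Phi (v + d) ≤ Phi (u + e) * Phi (v + e) := by
      gcongr; exact Phi_nonneg _
    refine le_trans ?_ h4
    have hd1 : 5 / 3 ≤ d := by nlinarith
    rcases le_total v (-1) with hv1 | hv1
    · have h := Phi_sub_le (v := v + 1) (d := 1) (by linarith) zero_le_one
      have hexp1 : Real.exp (-1 ^ 2 / 2) ≤ 6 / 7 := by
        rw [neg_div]
        exact exp_neg_le_of_one_le (by norm_num) (by norm_num)
      have h5 : Phi (v + 1) ≤ Phi (v + d) := Phi_mono (by linarith)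
      rw [add_sub_cancel_right] at h
      nlinarith [Phi_nonneg (v + 1)]
    · have h := Phi_sub_le (v := 0) (d := 2 / 3) le_rfl (by norm_num)
      have hexp1 : Real.exp (-(2 / 3) ^ 2 / 2) ≤ 81 / 100 := by
        rw [neg_div]
        exact exp_neg_le_of_one_le (by norm_num) (by norm_num)
      have h5 : Phi (2 / 3) ≤ Phi (v + d) := Phi_mono (by linarith)
      have h6 := Phi_add_Phi_neg (2 / 3)
      rw [zero_sub, Phi_zero] at h
      have h7 := Phi_mono hv
      rw [Phi_zero] at h7
      linarith

lemma measurableSet_Phi2 (ρ u v : ℝ) :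
    MeasurableSet {p : ℝ × ℝ | p.1 ≤ u ∧ ρ * p.1 + √(1 - ρ ^ 2) * p.2 ≤ v} :=
  (measurableSet_le measurable_fst measurable_const).inter
    (measurableSet_le
      ((measurable_fst.const_mul _).add (measurable_snd.const_mul _)) measurable_const)

lemma Phi2_mono {ρ u v u' v' : ℝ} (hu : u ≤ u') (hv : v ≤ v') : Phi2 ρ u v ≤ Phi2 ρ u' v' :=
  ENNReal.toReal_mono (measure_ne_top _ _)
    (measure_mono fun _ hp => ⟨hp.1.trans hu, hp.2.trans hv⟩)

lemma Phi2_le_Phi (ρ u v : ℝ) : Phi2 ρ u v ≤ Phi u := by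
  refine ENNReal.toReal_mono (measure_ne_top _ _) ?_
  calc _ ≤ ((gaussianReal 0 1).prod (gaussianReal 0 1)) (Iic u ×ˢ univ) :=
        measure_mono fun p hp => ⟨hp.1, mem_univ _⟩
    _ = _ := by rw [Measure.prod_prod, measure_univ, mul_one]

lemma Phi2_zero (u v : ℝ) : Phi2 0 u v = Phi u * Phi v := by
  have : {p : ℝ × ℝ | p.1 ≤ u ∧ 0 * p.1 + √(1 - 0 ^ 2) * p.2 ≤ v} = Iic u ×ˢ Iic v := by
    ext p; simp [Prod.le_def]
  rw [Phi2, this, Measure.prod_prod, ENNReal.toReal_mul, Phi, Phi]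

lemma sqrt_one_sub_sq_pos {r : ℝ} (hr : |r| < 1) : 0 < √(1 - r ^ 2) :=
  Real.sqrt_pos.2 (sub_pos.2 ((sq_lt_one_iff_abs_lt_one r).2 hr))

lemma Phi2_eq_integral {r : ℝ} (hr : |r| < 1) (b a : ℝ) :
    Phi2 r b a = ∫ y in Iic b, Phi ((a - r * y) / √(1 - r ^ 2)) ∂gaussianReal 0 1 := by
  have hσ := sqrt_one_sub_sq_pos hr
  have hmeas : Measurable fun y => Phi ((a - r * y) / √(1 - r ^ 2)) :=
    continuous_Phi.measurable.comp (by fun_prop)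
  rw [Phi2, Measure.prod_apply (measurableSet_Phi2 r b a),
    integral_eq_lintegral_of_nonneg_ae (ae_of_all _ fun y => Phi_nonneg _)
      hmeas.aestronglyMeasurable,
    ← lintegral_indicator measurableSet_Iic]
  congr 1
  refine lintegral_congr fun y => ?_
  by_cases hy : y ≤ b
  · rw [indicator_of_mem (show y ∈ Iic b from hy), Phi,
      ENNReal.ofReal_toReal (measure_ne_top _ _)]
    congr 1
    ext z
    simp only [mem_preimage, mem_ofPred_eq, hy, true_and, mem_Iic]
    rw [le_div_iff₀ hσ]
    constructor <;> intro h <;> linarith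
  · rw [indicator_of_notMem (show y ∉ Iic b from hy)]
    have : Prod.mk y ⁻¹' {p : ℝ × ℝ | p.1 ≤ b ∧ r * p.1 + √(1 - r ^ 2) * p.2 ≤ a} = ∅ := by
      ext z; simp [hy]
    rw [this, measure_empty]

lemma integrable_id_gaussianReal_std : Integrable (fun y : ℝ => y) (gaussianReal 0 1) :=
  (memLp_id_gaussianReal 1).integrable le_rfl

lemma setIntegral_gaussianReal_std (s : Set ℝ) (f : ℝ → ℝ) (hs : MeasurableSet s) :
    ∫ y in s, f y ∂gaussianReal 0 1 = ∫ y in s, stdPDF y * f y := by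
  rw [← integral_indicator hs, integral_gaussianReal_eq_integral_smul one_ne_zero,
    ← integral_indicator hs, gaussianPDFReal_zero_one]
  congr 1
  ext y
  by_cases hy : y ∈ s <;> simp [hy]

lemma hasDerivAt_sqrt_one_sub_sq {r : ℝ} (hr : |r| < 1) :
    HasDerivAt (fun r : ℝ => √(1 - r ^ 2)) (-r / √(1 - r ^ 2)) r := by
  have hσ := sqrt_one_sub_sq_pos hr
  have h := (((hasDerivAt_id r).pow 2).const_sub 1).sqrt (by simpa using (Real.sqrt_pos.1 hσ).ne')
  refine h.congr_deriv ?_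
  simp
  field_simp

lemma hasDerivAt_conditional_threshold {r : ℝ} (hr : |r| < 1) (α β y : ℝ) :
    HasDerivAt (fun r : ℝ => (α + β * r - r * y) / √(1 - r ^ 2))
      (β / √(1 - r ^ 2) + (r * (α + β * r) - y) / √(1 - r ^ 2) ^ 3) r := by
  have hσ := sqrt_one_sub_sq_pos hr
  have hsq : √(1 - r ^ 2) ^ 2 = 1 - r ^ 2 := Real.sq_sqrt (Real.sqrt_pos.1 hσ).le
  have h := ((((hasDerivAt_id r).const_mul β).const_add α).sub
    ((hasDerivAt_id r).mul_const y)).div (hasDerivAt_sqrt_one_sub_sq hr) hσ.ne'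
  refine h.congr_deriv ?_
  simp only [id, Pi.sub_apply]
  set σ := √(1 - r ^ 2)
  field_simp
  linear_combination (-y) * hsq

/-- The total derivative in `r` of `Φ_r(b, α + β r)`. -/
lemma hasDerivAt_Phi2 {r : ℝ} (hr : |r| < 1) (b α β : ℝ) :
    HasDerivAt (fun r => Phi2 r b (α + β * r))
      (stdPDF (α + β * r) * (β * Phi ((b - r * (α + β * r)) / √(1 - r ^ 2)) +
        stdPDF ((b - r * (α + β * r)) / √(1 - r ^ 2)) / √(1 - r ^ 2))) r := by
  obtain ⟨R, hrR, hR1⟩ := exists_between hr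
  have hR0 : 0 ≤ R := (abs_nonneg r).trans hrR.le
  have hs : Metric.ball (0 : ℝ) R ∈ 𝓝 r :=
    Metric.isOpen_ball.mem_nhds (by simpa using hrR)
  have hmem : ∀ x ∈ Metric.ball (0 : ℝ) R, |x| < R := fun x hx => by simpa using hx
  set τ := √(1 - R ^ 2) with hτ
  have hτ0 : 0 < τ := sqrt_one_sub_sq_pos (by rwa [abs_of_nonneg hR0])
  have hτle : ∀ x ∈ Metric.ball (0 : ℝ) R, τ ≤ √(1 - x ^ 2) := fun x hx => by
    apply Real.sqrt_le_sqrt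
    have := (sq_le_sq₀ (abs_nonneg x) hR0).2 (hmem x hx).le
    rw [sq_abs] at this
    linarith
  set F : ℝ → ℝ → ℝ := fun x y => Phi ((α + β * x - x * y) / √(1 - x ^ 2)) with hF
  set F' : ℝ → ℝ → ℝ := fun x y => stdPDF ((α + β * x - x * y) / √(1 - x ^ 2)) *
    (β / √(1 - x ^ 2) + (x * (α + β * x) - y) / √(1 - x ^ 2) ^ 3) with hF'
  have hFmeas : ∀ x, Measurable (F x) := fun x => continuous_Phi.measurable.comp (by fun_prop)
  have hF'meas : ∀ x, Measurable (F' x) := fun x =>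
    (continuous_stdPDF.measurable.comp (by fun_prop)).mul (by fun_prop)
  have key := hasDerivAt_integral_of_dominated_loc_of_deriv_le
    (μ := (gaussianReal 0 1).restrict (Iic b)) (F := F) (F' := F') (x₀ := r)
    (bound := fun y => |β| / τ + (|α| + |β| + |y|) / τ ^ 3) hs
    (Eventually.of_forall fun x => (hFmeas x).aestronglyMeasurable)
    (Integrable.of_bound (hFmeas r).aestronglyMeasurable 1 (ae_of_all _ fun y => by
      rw [Real.norm_of_nonneg (Phi_nonneg _)]; exact Phi_le_one _))
    (hF'meas r).aestronglyMeasurable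
    (ae_of_all _ fun y x hx => by
      have hτx := hτle x hx
      have hx1 : |x| ≤ 1 := ((hmem x hx).trans hR1).le
      have h1 : |x * (α + β * x) - y| ≤ |α| + |β| + |y| := by
        have h2 : |x * (α + β * x)| ≤ 1 * (|α| + |β| * 1) := by
          rw [abs_mul]
          gcongr
          refine (abs_add_le _ _).trans ?_
          rw [abs_mul]
          gcongr
        have h3 := abs_sub (x * (α + β * x)) y
        linarith
      simp only [hF', norm_mul, Real.norm_eq_abs]
      rw [abs_of_pos (stdPDF_pos _)]
      calc _ ≤ 1 * |β / √(1 - x ^ 2) + (x * (α + β * x) - y) / √(1 - x ^ 2) ^ 3| := by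
            gcongr; exact stdPDF_le_one _
        _ ≤ |β| / √(1 - x ^ 2) + |x * (α + β * x) - y| / √(1 - x ^ 2) ^ 3 := by
            rw [one_mul]
            refine (abs_add_le _ _).trans ?_
            rw [abs_div, abs_div, abs_of_nonneg (Real.sqrt_nonneg (1 - x ^ 2)),
              abs_of_nonneg (pow_nonneg (Real.sqrt_nonneg (1 - x ^ 2)) 3)]
        _ ≤ _ := by gcongr)
    ((integrable_const _).add (((integrable_const _).add
      integrable_id_gaussianReal_std.abs.restrict).div_const _))
    (ae_of_all _ fun y x hx => (hasDerivAt_Phi _).comp x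
      (hasDerivAt_conditional_threshold ((hmem x hx).trans hR1) α β y))
  obtain ⟨hint, hder⟩ := key
  have heq : (fun x => Phi2 x b (α + β * x)) =ᶠ[𝓝 r]
      fun x => ∫ y in Iic b, F x y ∂gaussianReal 0 1 := by
    filter_upwards [hs] with x hx
    exact Phi2_eq_integral ((hmem x hx).trans hR1) _ _
  refine (hder.congr_of_eventuallyEq heq).congr_deriv ?_
  have hσ := sqrt_one_sub_sq_pos hr
  have hsq : √(1 - r ^ 2) ^ 2 = 1 - r ^ 2 := Real.sq_sqrt (Real.sqrt_pos.1 hσ).le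
  rw [setIntegral_gaussianReal_std _ _ measurableSet_Iic]
  have hint' : IntegrableOn (fun y => stdPDF y * F' r y) (Iic b) := by
    rw [gaussianReal_of_var_ne_zero 0 one_ne_zero, restrict_withDensity measurableSet_Iic,
      integrable_withDensity_iff_integrable_smul' (measurable_gaussianPDF 0 1)
        (ae_of_all _ fun _ => gaussianPDF_lt_top)] at hint
    simp only [toReal_gaussianPDF, gaussianPDFReal_zero_one, smul_eq_mul] at hint
    exact hint
  set a := α + β * r with ha
  set σ := √(1 - r ^ 2) with hσdef
  have hanti : ∀ y ∈ Iic b, HasDerivAt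
      (fun y => stdPDF a * (β * Phi ((y - r * a) / σ) + stdPDF ((y - r * a) / σ) / σ))
      (stdPDF y * F' r y) y := fun y _ => by
    have hq : HasDerivAt (fun y => (y - r * a) / σ) (1 / σ) y :=
      ((hasDerivAt_id y).sub_const _).div_const _
    have h := ((((hasDerivAt_Phi _).comp y hq).const_mul β).add
      (((hasDerivAt_stdPDF _).comp y hq).div_const σ)).const_mul (stdPDF a)
    refine h.congr_deriv ?_
    have hprod : stdPDF y * stdPDF ((a - r * y) / σ) = stdPDF a * stdPDF ((y - r * a) / σ) := by
      apply stdPDF_mul_eq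
      field_simp
      rw [hsq]
      ring
    simp only [hF', ← ha, ← hσdef]
    rw [← mul_assoc (stdPDF y), hprod]
    field_simp
    ring
  have hlim : Tendsto
      (fun y => stdPDF a * (β * Phi ((y - r * a) / σ) + stdPDF ((y - r * a) / σ) / σ))
      atBot (𝓝 0) := by
    have hq : Tendsto (fun y => (y - r * a) / σ) atBot atBot :=
      (tendsto_atBot_add_const_right _ (-(r * a)) tendsto_id).atBot_div_const hσ
    have h := (((tendsto_Phi_atBot.comp hq).const_mul β).add
      ((tendsto_stdPDF_atBot.comp hq).div_const σ)).const_mul (stdPDF a)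
    simpa [Function.comp_def] using h
  rw [integral_Iic_of_hasDerivAt_of_tendsto' hanti hint' hlim, sub_zero]

lemma Phi2_comm {ρ : ℝ} (hρ0 : 0 ≤ ρ) (hρ1 : ρ < 1) (u v : ℝ) : Phi2 ρ u v = Phi2 ρ v u := by
  have hd : ∀ x ∈ Icc 0 ρ, HasDerivAt (fun r => Phi2 r u v - Phi2 r v u) 0 x := fun x hx => by
    have hx1 : |x| < 1 := by rw [abs_of_nonneg hx.1]; exact hx.2.trans_lt hρ1
    have hσ := sqrt_one_sub_sq_pos hx1
    have hsq : √(1 - x ^ 2) ^ 2 = 1 - x ^ 2 := Real.sq_sqrt (Real.sqrt_pos.1 hσ).le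
    have h := (hasDerivAt_Phi2 hx1 u v 0).sub (hasDerivAt_Phi2 hx1 v u 0)
    simp only [zero_mul, add_zero, zero_add] at h
    refine h.congr_deriv ?_
    have hprod : stdPDF v * stdPDF ((u - x * v) / √(1 - x ^ 2)) =
        stdPDF u * stdPDF ((v - x * u) / √(1 - x ^ 2)) := by
      apply stdPDF_mul_eq
      field_simp
      rw [hsq]
      ring
    rw [← mul_div_assoc, ← mul_div_assoc, hprod, sub_self]
  have h := constant_of_has_deriv_right_zero
    (fun x hx => (hd x hx).continuousAt.continuousWithinAt)
    (fun x hx => (hd x (Ico_subset_Icc_self hx)).hasDerivWithinAt) ρ ⟨hρ0, le_rfl⟩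
  simp only [Phi2_zero] at h
  linarith [mul_comm (Phi u) (Phi v)]

lemma Phi2_le_of_half_le_sqrt {ρ : ℝ} (hρ0 : 0 ≤ ρ) (hρ1 : ρ < 1)
    (hσ2 : 1 / 2 ≤ √(1 - ρ ^ 2)) {u v : ℝ} (hvu : v ≤ u) {κ : ℝ}
    (hκ : κ = 2 + (√(1 - ρ ^ 2))⁻¹ * max 0 (-u)) :
    Phi2 ρ u v ≤ Phi (u + κ * ρ) * Phi (v + κ * ρ) := by
  have hM0 : 0 ≤ max 0 (-u) := le_max_left _ _
  have hMu : -u ≤ max 0 (-u) := le_max_right _ _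
  set M := max 0 (-u)
  have hσ0 : 0 < √(1 - ρ ^ 2) := by linarith
  have hκ0 : 0 ≤ κ := by rw [hκ]; positivity
  set b := u + κ * ρ with hb
  have hκρ : 0 ≤ κ * ρ := mul_nonneg hκ0 hρ0
  have habs : ∀ x ∈ Icc 0 ρ, |x| < 1 := fun x hx => by
    rw [abs_of_nonneg hx.1]; exact hx.2.trans_lt hρ1
  have hanti : AntitoneOn (fun r => Phi2 r b (v + κ * ρ + (-κ) * r)) (Icc 0 ρ) := by
    refine antitoneOn_of_hasDerivWithinAt_nonpos (convex_Icc 0 ρ)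
      (fun x hx => (hasDerivAt_Phi2 (habs x hx) _ _ _).continuousAt.continuousWithinAt)
      (fun x hx => (hasDerivAt_Phi2 (habs x (interior_subset hx)) _ _ _).hasDerivWithinAt)
      (fun x hx => ?_)
    have hx' := interior_subset hx
    have hx0 : 0 ≤ x := hx'.1
    have hx1 : x < 1 := hx'.2.trans_lt hρ1
    have hσx := sqrt_one_sub_sq_pos (habs x hx')
    have hsq : √(1 - x ^ 2) ^ 2 = 1 - x ^ 2 := Real.sq_sqrt (Real.sqrt_pos.1 hσx).le
    have hle : √(1 - ρ ^ 2) ≤ √(1 - x ^ 2) := by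
      apply Real.sqrt_le_sqrt
      have := hx'.2
      nlinarith
    set a := v + κ * ρ + (-κ) * x
    have hab : a ≤ b := by
      have := mul_nonneg hκ0 hx0
      simp only [a, b]; linarith
    set s := (b - x * a) / √(1 - x ^ 2) with hs
    have h1x : 1 - x ≤ √(1 - x ^ 2) := Real.le_sqrt_of_sq_le (by nlinarith)
    have hsM : -s ≤ M := by
      rw [hs, ← neg_div, div_le_iff₀ hσx]
      have e1 : x * a ≤ x * b := by gcongr
      have e2 : -b * (1 - x) ≤ M * (1 - x) := by
        apply mul_le_mul_of_nonneg_right _ (by linarith)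
        linarith
      have e3 : M * (1 - x) ≤ M * √(1 - x ^ 2) := by gcongr
      linarith
    have hmills := stdPDF_le_mul_Phi s
    have hbound : stdPDF s / √(1 - x ^ 2) ≤ κ * Phi s := by
      have e1 : stdPDF s ≤ (1 + M) * Phi s :=
        hmills.trans (mul_le_mul_of_nonneg_right (by linarith [max_le hM0 hsM]) (Phi_nonneg s))
      have e2 : stdPDF s / √(1 - x ^ 2) ≤ stdPDF s / √(1 - ρ ^ 2) :=
        div_le_div_of_nonneg_left (stdPDF_pos s).le hσ0 hle
      have e3 : stdPDF s / √(1 - ρ ^ 2) ≤ (1 + M) * Phi s / √(1 - ρ ^ 2) := by gcongr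
      have e4 : (√(1 - ρ ^ 2))⁻¹ ≤ 2 := by
        rw [inv_le_comm₀ hσ0 two_pos]; linarith
      have e5 : (1 + M) * Phi s / √(1 - ρ ^ 2) ≤ κ * Phi s := by
        rw [hκ, div_eq_mul_inv, mul_right_comm]
        apply mul_le_mul_of_nonneg_right _ (Phi_nonneg s)
        linarith
      linarith
    apply mul_nonpos_of_nonneg_of_nonpos (stdPDF_pos _).le
    linarith
  have h := hanti (left_mem_Icc.2 hρ0) (right_mem_Icc.2 hρ0) hρ0
  simp only [mul_zero, add_zero, Phi2_zero] at h
  refine le_trans (Phi2_mono (by linarith) ?_) h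
  linarith

lemma Phi2_le_of_le {ρ : ℝ} (hρ0 : 0 ≤ ρ) (hρ1 : ρ < 1) {u v : ℝ} (hvu : v ≤ u) {κ : ℝ}
    (hκ : κ = 2 + (√(1 - ρ ^ 2))⁻¹ * max 0 (-u)) :
    Phi2 ρ u v ≤ Phi (u + κ * ρ) * Phi (v + κ * ρ) := by
  rcases le_total (1 / 2) (√(1 - ρ ^ 2)) with hσ2 | hσ2
  · exact Phi2_le_of_half_le_sqrt hρ0 hρ1 hσ2 hvu hκ
  rw [Phi2_comm hρ0 hρ1]
  refine (Phi2_le_Phi ρ v u).trans ?_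
  have hσ0 : 0 < √(1 - ρ ^ 2) := sqrt_one_sub_sq_pos (by rwa [abs_of_nonneg hρ0])
  have hsq : √(1 - ρ ^ 2) ^ 2 = 1 - ρ ^ 2 := Real.sq_sqrt (Real.sqrt_pos.1 hσ0).le
  have hM0 : 0 ≤ max 0 (-u) := le_max_left _ _
  have hMu : -u ≤ max 0 (-u) := le_max_right _ _
  set M := max 0 (-u)
  set σ := √(1 - ρ ^ 2)
  have hρσ : 1 ≤ σ⁻¹ * ρ := by
    rw [inv_mul_eq_div, one_le_div hσ0]
    nlinarith
  have hκρ : κ * ρ = 2 * ρ + σ⁻¹ * ρ * M := by rw [hκ]; ring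
  have hM : M ≤ σ⁻¹ * ρ * M := le_mul_of_one_le_left hM0 hρσ
  exact Phi_le_Phi_mul_Phi (d := 2 * ρ) hvu (by nlinarith) (by linarith) (by linarith)
    (by linarith)

theorem stmt9 (ρ : ℝ) (hρ0 : 0 ≤ ρ) (hρ1 : ρ < 1) (u v : ℝ)
    (κ : ℝ) (hκ : κ = 2 + (Real.sqrt (1 - ρ ^ 2))⁻¹ * max 0 (-(max u v))) :
    Phi2 ρ u v ≤ Phi (u + κ * ρ) * Phi (v + κ * ρ) := by
  rcases le_total v u with h | h
  · rw [max_eq_left h] at hκ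
    exact Phi2_le_of_le hρ0 hρ1 h hκ
  · rw [max_eq_right h] at hκ
    rw [Phi2_comm hρ0 hρ1, mul_comm]
    exact Phi2_le_of_le hρ0 hρ1 h hκ
end

section
/- Let $X$ be a Gaussian vector, $I \subseteq \{1,\ldots,n\}$, and define the capacity $\mathrm{Cap}(I) = (\inf_{\mu \in \mathcal{P}(I)} \sum_{i,j \in I}\mu(i)K(i,j)\mu(j))^{-1}$, where $\mathcal{P}(I)$ is the set of probability measures on $I$. Then for every increasing event $A \in \sigma(I)$ and every $\varepsilon > 0$: $\Pr[X + \varepsilon\mathbf{1} \in A] - \Pr[X \in A] \le \frac{\varepsilon}{2}\sqrt{\mathrm{Cap}(I)}$. -/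
open MeasureTheory ProbabilityTheory
open scoped ENNReal

/-- An event `A ⊆ ℝⁿ` is increasing if it is closed under adding coordinatewise
nonnegative vectors. -/
def IncreasingEvent {n : ℕ} (A : Set (Fin n → ℝ)) : Prop :=
  ∀ x ∈ A, ∀ v : Fin n → ℝ, (∀ i, 0 ≤ v i) → x + v ∈ A

/-- An event `A` is supported on `I` if membership is unchanged by modifying
coordinates outside `I`. -/
def SupportedOn {n : ℕ} (A : Set (Fin n → ℝ)) (I : Set (Fin n)) : Prop :=
  ∀ x y : Fin n → ℝ, (∀ i ∈ I, x i = y i) → (x ∈ A ↔ y ∈ A)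

/-- `X` is a Gaussian vector: every linear combination of coordinates is Gaussian. -/
def IsGaussianVector {Ω : Type*} [MeasureSpace Ω] {n : ℕ} (X : Ω → Fin n → ℝ) : Prop :=
  ∀ a : Fin n → ℝ, ∃ (m : ℝ) (v : NNReal),
    Measure.map (fun ω => ∑ i, a i * X ω i) ℙ = gaussianReal m v

/-- The threshold `T_A(x) = sup {u : x - u·𝟙 ∈ A}` of an increasing event. -/
noncomputable def thr {n : ℕ} (A : Set (Fin n → ℝ)) (x : Fin n → ℝ) : ℝ :=
  sSup {u : ℝ | (fun i => x i - u) ∈ A}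

/-- `‖K_{I₁,I₂}‖_∞ = max_{i ∈ I₁, j ∈ I₂} |K(i,j)|`. -/
noncomputable def kNorm {n : ℕ} (K : Fin n → Fin n → ℝ) (I1 I2 : Finset (Fin n)) : ℝ :=
  sSup {r : ℝ | ∃ i ∈ I1, ∃ j ∈ I2, r = |K i j|}

/-- The capacity `Cap(I) = (inf_{μ ∈ P(I)} ∑_{i,j ∈ I} μ(i) K(i,j) μ(j))⁻¹ ∈ [0,∞]`,
where `P(I)` is the set of probability measures on `I`. -/
noncomputable def gCap {n : ℕ} (K : Fin n → Fin n → ℝ) (I : Finset (Fin n)) : ℝ≥0∞ :=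
  (sInf {r : ℝ≥0∞ | ∃ μ : Fin n → ℝ, (∀ i, 0 ≤ μ i) ∧ (∀ i ∉ I, μ i = 0) ∧
    (∑ i ∈ I, μ i) = 1 ∧
    r = ENNReal.ofReal (∑ i ∈ I, ∑ j ∈ I, μ i * K i j * μ j)})⁻¹

lemma IsGaussianVector.hasGaussianLaw {Ω : Type*} [MeasureSpace Ω]
    [IsProbabilityMeasure (ℙ : Measure Ω)] {n : ℕ} {X : Ω → Fin n → ℝ}
    (hX : IsGaussianVector X) : HasGaussianLaw X ℙ := by
  have hcoord (i : Fin n) : AEMeasurable (fun ω ↦ X ω i) ℙ := by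
    obtain ⟨m, v, h⟩ := hX (Pi.single i 1)
    have h' : (fun ω ↦ ∑ j, (Pi.single i 1 : Fin n → ℝ) j * X ω j) = fun ω ↦ X ω i := by
      ext ω
      simp [Pi.single_apply]
    rw [h'] at h
    refine AEMeasurable.of_map_ne_zero ?_
    rw [h]
    exact IsProbabilityMeasure.ne_zero _
  have hmeas : AEMeasurable X ℙ := aemeasurable_pi_iff.mpr hcoord
  refine ⟨isGaussian_of_map_eq_gaussianReal fun L ↦ ?_⟩
  obtain ⟨m, v, h⟩ := hX fun i ↦ L (Pi.single i 1)
  refine ⟨m, v, ?_⟩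
  rw [← h, AEMeasurable.map_map_of_aemeasurable L.continuous.measurable.aemeasurable hmeas]
  congr 1
  ext ω
  rw [Function.comp_apply, ← L.coe_coe, LinearMap.pi_apply_eq_sum_univ L.toLinearMap (X ω)]
  refine Finset.sum_congr rfl fun i _ ↦ ?_
  rw [smul_eq_mul, mul_comm]
  congr 2
  ext j
  simp [Pi.single_apply, eq_comm]

lemma gaussianPDFReal_le (m : ℝ) (v : NNReal) (x : ℝ) :
    gaussianPDFReal m v x ≤ (2 * √(v : ℝ))⁻¹ := by
  rw [gaussianPDFReal_def]
  have hexp : Real.exp (-(x - m) ^ 2 / (2 * v)) ≤ 1 :=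
    Real.exp_le_one_iff.mpr
      (div_nonpos_of_nonpos_of_nonneg (neg_nonpos.mpr (sq_nonneg _)) (by positivity))
  rcases eq_or_ne v 0 with rfl | hv
  · simp
  have hv' : (0 : ℝ) < v := by positivity
  have hsqrt : 2 * √(v : ℝ) ≤ √(2 * Real.pi * v) := by
    refine Real.le_sqrt_of_sq_le ?_
    rw [mul_pow, Real.sq_sqrt hv'.le]
    nlinarith [Real.two_le_pi]
  calc (√(2 * Real.pi * v))⁻¹ * Real.exp (-(x - m) ^ 2 / (2 * v))
      ≤ (√(2 * Real.pi * v))⁻¹ * 1 := by gcongr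
    _ ≤ (2 * √(v : ℝ))⁻¹ := by
      rw [mul_one]
      exact inv_anti₀ (by positivity) hsqrt

lemma gaussianReal_le_mul_volume (m : ℝ) {v : NNReal} (hv : v ≠ 0) (s : Set ℝ) :
    gaussianReal m v s ≤ ENNReal.ofReal (2 * √(v : ℝ))⁻¹ * volume s := by
  rw [gaussianReal_apply m hv]
  calc ∫⁻ x in s, gaussianPDF m v x
      ≤ ∫⁻ _ in s, ENNReal.ofReal (2 * √(v : ℝ))⁻¹ :=
        lintegral_mono fun x ↦ ENNReal.ofReal_le_ofReal (gaussianPDFReal_le m v x)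
    _ = _ := by simp

/-- A minimizer of a quadratic form over the probability measures on `I` has potential at least
its energy everywhere on `I`. -/
lemma exists_energy_le_potential {n : ℕ} (K : Fin n → Fin n → ℝ) (hsymm : ∀ i j, K i j = K j i)
    (I : Finset (Fin n)) (hI : I.Nonempty) :
    ∃ μ : Fin n → ℝ, (∀ i, 0 ≤ μ i) ∧ (∀ i ∉ I, μ i = 0) ∧ ∑ i ∈ I, μ i = 1 ∧
      ∀ i ∈ I, ∑ k ∈ I, ∑ j ∈ I, μ k * K k j * μ j ≤ ∑ j ∈ I, K i j * μ j := by
  set S : Set (Fin n → ℝ) := stdSimplex ℝ (Fin n) ∩ {μ | ∀ i ∉ I, μ i = 0}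
  have hmem (μ : Fin n → ℝ) (h0 : ∀ i, 0 ≤ μ i) (h1 : ∀ i ∉ I, μ i = 0) (h2 : ∑ i ∈ I, μ i = 1) :
      μ ∈ S := by
    refine ⟨⟨h0, ?_⟩, h1⟩
    rw [← h2]
    exact (Finset.sum_subset (Finset.subset_univ _) fun i _ hi ↦ h1 i hi).symm
  have hclosed : IsClosed {μ : Fin n → ℝ | ∀ i ∉ I, μ i = 0} := by
    simp only [Set.ofPred_forall]
    exact isClosed_iInter fun i ↦ isClosed_iInter fun _ ↦
      isClosed_eq (continuous_apply i) continuous_const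
  have hcompact : IsCompact S := (isCompact_stdSimplex ℝ (Fin n)).inter_right hclosed
  have hne : S.Nonempty := by
    obtain ⟨i, hi⟩ := hI
    refine ⟨Pi.single i 1, hmem _ (fun j ↦ ?_) (fun j hj ↦ ?_) ?_⟩
    · rw [Pi.single_apply]
      positivity
    · rw [Pi.single_apply, if_neg]
      rintro rfl
      exact hj hi
    · simp [Pi.single_apply, hi]
  obtain ⟨μ, hμS, hmin⟩ := hcompact.exists_isMinOn hne
    (f := fun μ ↦ ∑ k ∈ I, ∑ j ∈ I, μ k * K k j * μ j) (by fun_prop)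
  obtain ⟨⟨hμ0, hμ1⟩, hμI⟩ := hμS
  have hμsum : ∑ i ∈ I, μ i = 1 := by
    rw [← hμ1]
    exact Finset.sum_subset (Finset.subset_univ _) fun i _ hi ↦ hμI i hi
  refine ⟨μ, hμ0, hμI, hμsum, fun i hi ↦ ?_⟩
  set Q := ∑ k ∈ I, ∑ j ∈ I, μ k * K k j * μ j with hQ
  set g := ∑ j ∈ I, K i j * μ j with hg
  have key (t : ℝ) (ht0 : 0 ≤ t) (ht1 : t ≤ 1) :
      Q ≤ (1 - t) ^ 2 * Q + 2 * t * (1 - t) * g + t ^ 2 * K i i := by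
    have hS' : (fun j ↦ (1 - t) * μ j + t * (Pi.single i 1 : Fin n → ℝ) j) ∈ S := by
      refine hmem _ (fun j ↦ ?_) (fun j hj ↦ ?_) ?_
      · have h1 : 0 ≤ 1 - t := by linarith
        have h2 := hμ0 j
        rw [Pi.single_apply]
        positivity
      · have : j ≠ i := by
          rintro rfl
          exact hj hi
        simp [hμI j hj, this]
      · rw [Finset.sum_add_distrib, ← Finset.mul_sum, ← Finset.mul_sum, hμsum]
        simp [Pi.single_apply, hi]
    refine (hmin hS').trans_eq ?_
    have hexpand (k j : Fin n) :
        ((1 - t) * μ k + t * (Pi.single i 1 : Fin n → ℝ) k) * K k j *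
          ((1 - t) * μ j + t * (Pi.single i 1 : Fin n → ℝ) j) =
        (1 - t) ^ 2 * (μ k * K k j * μ j) +
          t * (1 - t) * ((Pi.single i 1 : Fin n → ℝ) k * (K k j * μ j)) +
          t * (1 - t) * ((Pi.single i 1 : Fin n → ℝ) j * (K j k * μ k)) +
          t ^ 2 * ((Pi.single i 1 : Fin n → ℝ) k * ((Pi.single i 1 : Fin n → ℝ) j * K k j)) := by
      rw [hsymm j k]
      ring
    simp only [hexpand, Finset.sum_add_distrib, ← Finset.mul_sum, ← hQ]
    simp only [Pi.single_apply, ite_mul, one_mul, zero_mul, Finset.sum_ite_eq', hi, if_true,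
      ← hg]
    ring
  by_contra! hlt
  set c := |Q - 2 * g + K i i| + 2 * (Q - g) with hc
  have hcpos : 0 < c := by
    have := abs_nonneg (Q - 2 * g + K i i)
    linarith
  set t := (Q - g) / c with ht
  have htc : t * c = Q - g := div_mul_cancel₀ _ hcpos.ne'
  have ht0 : 0 < t := div_pos (by linarith) hcpos
  have ht1 : t ≤ 1 := by
    rw [ht, div_le_one hcpos]
    have := abs_nonneg (Q - 2 * g + K i i)
    linarith
  have h1 := key t ht0.le ht1
  have h2 : t * (2 * (Q - g)) ≤ t * (t * (Q - 2 * g + K i i)) := by linarith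
  have h3 := le_of_mul_le_mul_left h2 ht0
  have h4 : t * (Q - 2 * g + K i i) ≤ t * c := by
    refine mul_le_mul_of_nonneg_left ?_ ht0.le
    have := le_abs_self (Q - 2 * g + K i i)
    linarith
  linarith

/-- Translating the closure of an increasing event supported on `I` in a direction that is positive
on `I` lands in the interior of the event. -/
lemma IncreasingEvent.add_mem_interior {n : ℕ} {A : Set (Fin n → ℝ)} (hInc : IncreasingEvent A)
    {I : Finset (Fin n)} (hSupp : SupportedOn A ↑I) {x h : Fin n → ℝ} (hx : x ∈ closure A)
    {δ : ℝ} (hδ : 0 < δ) (hh : ∀ i ∈ I, δ ≤ h i) : x + h ∈ interior A := by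
  obtain ⟨y, hyA, hxy⟩ := Metric.mem_closure_iff.mp hx (δ / 2) (by positivity)
  rw [mem_interior_iff_mem_nhds, Metric.mem_nhds_iff]
  refine ⟨δ / 2, by positivity, fun z hz ↦ ?_⟩
  have hle (i : Fin n) (hi : i ∈ I) : y i ≤ z i := by
    have h1 := (dist_le_pi_dist x y i).trans_lt hxy
    have h2 := (dist_le_pi_dist z (x + h) i).trans_lt (Metric.mem_ball.mp hz)
    rw [Real.dist_eq, abs_lt] at h1 h2
    have := hh i hi
    simp only [Pi.add_apply] at h2
    linarith
  have := hInc y hyA (fun i ↦ max (z i - y i) 0) fun i ↦ le_max_right _ _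
  refine (hSupp _ _ fun i hi ↦ ?_).mp this
  have := hle i hi
  simp [this]

/-- If the covariance of every coordinate in `I` with a linear combination `Y` of the coordinates of
a Gaussian vector is at least the variance of `Y`, then shifting by `ε` raises the probability of an
increasing event supported on `I` by at most `ε / (2 √Var Y)`. -/
lemma IncreasingEvent.measure_add_const_le {Ω : Type*} [MeasurableSpace Ω] {P : Measure Ω}
    {n : ℕ} {X : Ω → Fin n → ℝ} (hX : HasGaussianLaw X P)
    {I : Finset (Fin n)} {A : Set (Fin n → ℝ)} (hInc : IncreasingEvent A)
    (hSupp : SupportedOn A ↑I) {ε : ℝ} (hε : 0 < ε) (μ : Fin n → ℝ)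
    (hvar : 0 < Var[fun ω ↦ ∑ j, μ j * X ω j; P])
    (hcov : ∀ i ∈ I, Var[fun ω ↦ ∑ j, μ j * X ω j; P] ≤
      cov[fun ω ↦ X ω i, fun ω ↦ ∑ j, μ j * X ω j; P]) :
    P {ω | (fun i ↦ X ω i + ε) ∈ A} ≤
      P {ω | X ω ∈ A} +
        ENNReal.ofReal (ε / (2 * √(Var[fun ω ↦ ∑ j, μ j * X ω j; P]))) := by
  have := hX.isProbabilityMeasure
  set Y : Ω → ℝ := fun ω ↦ ∑ j, μ j * X ω j with hY
  set q := Var[Y; P] with hq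
  set h : Fin n → ℝ := fun i ↦ cov[fun ω ↦ X ω i, Y; P] / q with hh
  set R : Ω → Fin n → ℝ := fun ω ↦ X ω - Y ω • h with hR
  have hh1 (i : Fin n) (hi : i ∈ I) : 1 ≤ h i := by
    rw [hh, one_le_div hvar]
    exact hcov i hi
  let LY : (Fin n → ℝ) →L[ℝ] ℝ := ∑ j, μ j • ContinuousLinearMap.proj j
  have hLY (x : Fin n → ℝ) : LY x = ∑ j, μ j * x j := by simp [LY]
  have hYlaw : HasGaussianLaw Y P := by
    have := hX.map_fun LY
    simpa only [hLY] using this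
  have hY2 : MemLp Y 2 P := hYlaw.memLp_two
  have hX2 (i : Fin n) : MemLp (fun ω ↦ X ω i) 2 P :=
    (hX.map_fun (ContinuousLinearMap.proj (R := ℝ) (φ := fun _ : Fin n ↦ ℝ) i)).memLp_two
  have hpair : HasGaussianLaw (fun ω ↦ ((fun _ : Unit ↦ Y ω), fun i ↦ R ω i)) P := by
    have hL (ω : Ω) : ((ContinuousLinearMap.pi fun _ : Unit ↦ LY).prod
        (ContinuousLinearMap.id ℝ (Fin n → ℝ) - LY.smulRight h)) (X ω) =
        ((fun _ : Unit ↦ Y ω), fun i ↦ R ω i) := by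
      refine Prod.ext ?_ ?_
      · ext
        simp [hLY, hY]
      · ext i
        simp [hLY, hY, hR]
    simpa only [hL] using hX.map_fun ((ContinuousLinearMap.pi fun _ : Unit ↦ LY).prod
      (ContinuousLinearMap.id ℝ (Fin n → ℝ) - LY.smulRight h))
  have hindep : IndepFun Y R P := by
    have := HasGaussianLaw.indepFun_of_covariance_eval (X := fun _ : Unit ↦ Y)
      (Y := fun i ω ↦ R ω i) hpair fun _ i ↦ by
        have : (fun ω ↦ R ω i) = fun ω ↦ X ω i - Y ω * h i := by
          ext ω
          simp [hR]
        rw [this, covariance_fun_sub_right hY2 (hX2 i) (hY2.mul_const _),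
          covariance_mul_const_right, covariance_self hY2.aemeasurable, ← hq, hh,
          mul_div_cancel₀ _ hvar.ne', covariance_comm, sub_self]
    exact this.comp (φ := fun y : Unit → ℝ ↦ y ()) (ψ := id) (measurable_pi_apply _) measurable_id
  have hRmeas : AEMeasurable R P := hpair.snd.aemeasurable
  have hprod := (indepFun_iff_map_prod_eq_prod_map_map hYlaw.aemeasurable hRmeas).mp hindep
  set D : Set (ℝ × (Fin n → ℝ)) :=
    {p | p.2 + (p.1 + ε) • h ∈ closure A ∧ p.2 + p.1 • h ∉ interior A} with hD
  have hDmeas : MeasurableSet D := by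
    refine IsClosed.measurableSet (IsClosed.inter ?_ ?_)
    · exact isClosed_closure.preimage (by fun_prop)
    · exact isOpen_interior.isClosed_compl.preimage
        (f := fun p : ℝ × (Fin n → ℝ) ↦ p.2 + p.1 • h) (by fun_prop)
  have hsub : {ω | (fun i ↦ X ω i + ε) ∈ A} ⊆ {ω | X ω ∈ A} ∪ (fun ω ↦ (Y ω, R ω)) ⁻¹' D := by
    intro ω hω
    by_cases hωA : X ω ∈ A
    · exact Or.inl hωA
    refine Or.inr ⟨subset_closure ?_, fun hmem ↦ hωA ?_⟩
    · have := hInc _ hω (fun i ↦ max (ε * h i - ε) 0) fun i ↦ le_max_right _ _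
      refine (hSupp _ _ fun i hi ↦ ?_).mp this
      have h1 : ε ≤ ε * h i := le_mul_of_one_le_right hε.le (hh1 i hi)
      simp only [Pi.add_apply, hR, Pi.sub_apply, Pi.smul_apply, smul_eq_mul,
        max_eq_left (sub_nonneg.mpr h1)]
      ring
    · simpa [hR] using interior_subset hmem
  have hsection (r : Fin n → ℝ) : volume ((fun y ↦ (y, r)) ⁻¹' D) ≤ ENNReal.ofReal ε := by
    refine (Real.volume_le_diam _).trans (Metric.ediam_le_of_forall_dist_le ?_)
    have hone (y z : ℝ) (hy : (y, r) ∈ D) (hz : (z, r) ∈ D) : z - y ≤ ε := by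
      by_contra! hlt
      refine hz.2 ?_
      have := hInc.add_mem_interior hSupp hy.1 (h := (z - y - ε) • h) (δ := z - y - ε)
        (by linarith) fun i hi ↦ le_mul_of_one_le_right (by linarith) (hh1 i hi)
      rwa [add_assoc, ← add_smul, show y + ε + (z - y - ε) = z by ring] at this
    intro y hy z hz
    rw [Real.dist_eq, abs_le]
    constructor
    · linarith [hone y z hy hz]
    · exact hone z y hz hy
  have hYmap : P.map Y = gaussianReal (P[Y]) q.toNNReal := hYlaw.map_eq_gaussianReal
  have hDle : P ((fun ω ↦ (Y ω, R ω)) ⁻¹' D) ≤ ENNReal.ofReal (ε / (2 * √q)) := by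
    have : IsProbabilityMeasure (P.map R) := Measure.isProbabilityMeasure_map hRmeas
    rw [← Measure.map_apply_of_aemeasurable (hYlaw.aemeasurable.prodMk hRmeas) hDmeas, hprod,
      hYmap, Measure.prod_apply_symm hDmeas]
    calc ∫⁻ r, gaussianReal (P[Y]) q.toNNReal ((fun y ↦ (y, r)) ⁻¹' D) ∂(P.map R)
        ≤ ∫⁻ _, ENNReal.ofReal (ε / (2 * √q)) ∂(P.map R) := by
          refine lintegral_mono fun r ↦ ?_
          refine (gaussianReal_le_mul_volume _ (Real.toNNReal_pos.mpr hvar).ne' _).trans ?_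
          refine (mul_le_mul_right (hsection r) _).trans_eq ?_
          rw [← ENNReal.ofReal_mul (by positivity), Real.coe_toNNReal _ hvar.le, div_eq_inv_mul]
      _ = _ := by simp
  calc P {ω | (fun i ↦ X ω i + ε) ∈ A}
      ≤ P ({ω | X ω ∈ A} ∪ (fun ω ↦ (Y ω, R ω)) ⁻¹' D) := measure_mono hsub
    _ ≤ P {ω | X ω ∈ A} + P ((fun ω ↦ (Y ω, R ω)) ⁻¹' D) := measure_union_le _ _
    _ ≤ _ := by gcongr

lemma inv_sqrt_energy_le_gCap_rpow {n : ℕ} (K : Fin n → Fin n → ℝ) (I : Finset (Fin n))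
    (μ : Fin n → ℝ) (h0 : ∀ i, 0 ≤ μ i) (hI : ∀ i ∉ I, μ i = 0) (h1 : ∑ i ∈ I, μ i = 1) :
    (ENNReal.ofReal √(∑ i ∈ I, ∑ j ∈ I, μ i * K i j * μ j))⁻¹ ≤ gCap K I ^ (1 / 2 : ℝ) := by
  rw [Real.sqrt_eq_rpow, gCap, ENNReal.inv_rpow]
  refine ENNReal.inv_le_inv.mpr ?_
  have hle : sInf {r : ℝ≥0∞ | ∃ μ : Fin n → ℝ, (∀ i, 0 ≤ μ i) ∧ (∀ i ∉ I, μ i = 0) ∧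
      (∑ i ∈ I, μ i) = 1 ∧ r = ENNReal.ofReal (∑ i ∈ I, ∑ j ∈ I, μ i * K i j * μ j)} ≤
      ENNReal.ofReal (∑ i ∈ I, ∑ j ∈ I, μ i * K i j * μ j) := sInf_le ⟨μ, h0, hI, h1, rfl⟩
  refine (ENNReal.rpow_le_rpow hle (by norm_num)).trans ?_
  rcases le_total 0 (∑ i ∈ I, ∑ j ∈ I, μ i * K i j * μ j) with hq | hq
  · rw [ENNReal.ofReal_rpow_of_nonneg hq (by norm_num)]
  · rw [ENNReal.ofReal_of_nonpos hq, ENNReal.zero_rpow_of_pos (by norm_num)]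
    exact zero_le

theorem stmt14 {n : ℕ} {Ω : Type*} [MeasureSpace Ω]
    [IsProbabilityMeasure (ℙ : Measure Ω)]
    (X : Ω → Fin n → ℝ) (hX : IsGaussianVector X)
    (K : Fin n → Fin n → ℝ)
    (hK : ∀ i j, K i j = ∫ ω, X ω i * X ω j ∂ℙ -
      (∫ ω, X ω i ∂ℙ) * (∫ ω, X ω j ∂ℙ))
    (I : Finset (Fin n)) (A : Set (Fin n → ℝ))
    (hInc : IncreasingEvent A) (hSupp : SupportedOn A ↑I)
    (ε : ℝ) (hε : 0 < ε) :
    ENNReal.ofReal ((ℙ {ω | (fun i => X ω i + ε) ∈ A}).toReal -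
        (ℙ {ω | X ω ∈ A}).toReal) ≤
      ENNReal.ofReal (ε / 2) * gCap K I ^ (1 / 2 : ℝ) := by
  rcases I.eq_empty_or_nonempty with rfl | hI
  · have : {ω | (fun i => X ω i + ε) ∈ A} = {ω | X ω ∈ A} := by
      ext ω
      exact hSupp _ _ (by simp)
    simp [this]
  have hG := hX.hasGaussianLaw
  have hX2 (i : Fin n) : MemLp (fun ω ↦ X ω i) 2 ℙ :=
    (hG.map_fun (ContinuousLinearMap.proj (R := ℝ) (φ := fun _ : Fin n ↦ ℝ) i)).memLp_two
  have hKcov (i j : Fin n) : K i j = cov[fun ω ↦ X ω i, fun ω ↦ X ω j; ℙ] := by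
    rw [hK, covariance_eq_sub (hX2 i) (hX2 j)]
    rfl
  obtain ⟨μ, hμ0, hμI, hμ1, hpot⟩ := exists_energy_le_potential K
    (fun i j ↦ by rw [hKcov, hKcov, covariance_comm]) I hI
  have hcap := inv_sqrt_energy_le_gCap_rpow K I μ hμ0 hμI hμ1
  set q := ∑ i ∈ I, ∑ j ∈ I, μ i * K i j * μ j with hq
  have hμX2 (j : Fin n) : MemLp (fun ω ↦ μ j * X ω j) 2 ℙ := (hX2 j).const_mul _
  have hcov (i : Fin n) :
      cov[fun ω ↦ X ω i, fun ω ↦ ∑ j, μ j * X ω j; ℙ] = ∑ j ∈ I, K i j * μ j := by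
    rw [covariance_fun_sum_right hμX2 (hX2 i),
      Finset.sum_subset (Finset.subset_univ I) fun j _ hj ↦ by rw [hμI j hj, mul_zero]]
    refine Finset.sum_congr rfl fun j _ ↦ ?_
    rw [covariance_const_mul_right, ← hKcov, mul_comm]
  have hvar : Var[fun ω ↦ ∑ j, μ j * X ω j; ℙ] = q := by
    have hsum : MemLp (fun ω ↦ ∑ j, μ j * X ω j) 2 ℙ := memLp_finsetSum _ fun j _ ↦ hμX2 j
    rw [← covariance_self hsum.aemeasurable, covariance_fun_sum_left hμX2 hsum, hq,
      Finset.sum_subset (Finset.subset_univ I) fun j _ hj ↦ by simp [hμI j hj]]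
    refine Finset.sum_congr rfl fun i _ ↦ ?_
    rw [covariance_const_mul_left, hcov, Finset.mul_sum]
    simp only [mul_assoc]
  rcases le_or_gt q 0 with hq0 | hq0
  · rw [Real.sqrt_eq_zero_of_nonpos hq0, ENNReal.ofReal_zero, ENNReal.inv_zero, top_le_iff] at hcap
    rw [hcap, ENNReal.mul_top (ENNReal.ofReal_pos.mpr (by positivity)).ne']
    exact le_top
  have hbound := hInc.measure_add_const_le hG hSupp hε μ (by rwa [hvar])
    fun i hi ↦ by rw [hvar, hcov]; exact hpot i hi
  rw [hvar] at hbound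
  calc ENNReal.ofReal ((ℙ {ω | (fun i => X ω i + ε) ∈ A}).toReal - (ℙ {ω | X ω ∈ A}).toReal)
      ≤ ENNReal.ofReal (ε / (2 * √q)) := by
        rw [ENNReal.ofReal_sub _ ENNReal.toReal_nonneg, ENNReal.ofReal_toReal (measure_ne_top _ _),
          ENNReal.ofReal_toReal (measure_ne_top _ _)]
        exact tsub_le_iff_left.mpr hbound
    _ = ENNReal.ofReal (ε / 2) * (ENNReal.ofReal √q)⁻¹ := by
        rw [← ENNReal.ofReal_inv_of_pos (by positivity), ← ENNReal.ofReal_mul (by positivity)]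
        congr 1
        field_simp
    _ ≤ _ := by gcongr
end

section
/- Let $(X, Y)$ be a $(1+m)$-dimensional Gaussian vector and suppose there exists $\delta > 0$ with $\det\mathrm{Cov}[Y] > \delta$ and $\max\{\|\mathbb{E}[(X,Y)]\|_\infty, \|\mathrm{Cov}[(X,Y)]\|_\infty\} < 1/\delta$. Then for every proper subset $I \subset \{1,\ldots,m\}$, $\det\mathrm{Cov}[Y|_I] \ge m^{-m}\delta^{m+1}$. -/
open MeasureTheory ProbabilityTheory

open scoped Matrix in
/-- Adjoining one index to a principal submatrix of a positive definite matrix multiplies its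
determinant by at most the new diagonal entry. -/
lemma Matrix.PosDef.det_submatrix_insert_le {n : Type*} [DecidableEq n] {A : Matrix n n ℝ}
    (hA : A.PosDef) (S : Finset n) {a : n} (ha : a ∉ S) :
    (A.submatrix ((↑) : ↥(insert a S) → n) (↑)).det ≤
      (A.submatrix ((↑) : S → n) (↑)).det * A a a := by
  set P : Matrix S S ℝ := A.submatrix (↑) (↑) with hP
  set B : Matrix S Unit ℝ := A.submatrix (↑) (fun _ => a) with hB
  have hPd : P.PosDef := hA.submatrix Subtype.val_injective
  let e : S ⊕ Unit ≃ ↥(insert a S) :=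
    (Equiv.optionEquivSumPUnit S).symm.trans (Finset.subtypeInsertEquivOption ha).symm
  have hblocks : (A.submatrix ((↑) : ↥(insert a S) → n) (↑)).submatrix e e =
      Matrix.fromBlocks P B Bᴴ (A.submatrix (fun _ => a) (fun _ => a)) := by
    ext (i | i) (j | j)
    · rfl
    · rfl
    · exact (hA.isHermitian.apply _ _).symm
    · rfl
  have hSchur : 0 ≤ (Bᴴ * P⁻¹ * B) () () :=
    (hPd.inv.posSemidef.conjTranspose_mul_mul_same B).diag_nonneg
  have : Invertible P := hPd.isUnit.invertible
  rw [← Matrix.det_submatrix_equiv_self e, hblocks, Matrix.det_fromBlocks₁₁,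
    Matrix.det_unique (n := Unit)]
  refine mul_le_mul_of_nonneg_left ?_ hPd.det_pos.le
  rw [Matrix.invOf_eq_nonsing_inv]
  simpa using hSchur

/-- A Fischer–Hadamard bound for principal minors of a positive definite matrix. -/
lemma Matrix.PosDef.det_submatrix_union_le {n : Type*} [DecidableEq n] {A : Matrix n n ℝ}
    (hA : A.PosDef) {b : ℝ} (hb : ∀ i, A i i ≤ b) (S T : Finset n) (hST : Disjoint T S) :
    (A.submatrix ((↑) : ↥(T ∪ S) → n) (↑)).det ≤
      (A.submatrix ((↑) : S → n) (↑)).det * b ^ T.card := by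
  induction T using Finset.induction_on with
  | empty =>
    rw [Finset.empty_union, Finset.card_empty, pow_zero, mul_one]
  | insert a T haT ih =>
    rw [Finset.disjoint_insert_left] at hST
    rw [Finset.insert_union, Finset.card_insert_of_notMem haT, pow_succ, ← mul_assoc]
    have hb0 : 0 ≤ b := hA.diag_pos.le.trans (hb a)
    have hdet := (hA.submatrix (e := ((↑) : ↥(T ∪ S) → n)) Subtype.val_injective).det_pos.le
    exact (hA.det_submatrix_insert_le _ (by simp [haT, hST.1])).trans
      (mul_le_mul (ih hST.2) (hb a) hA.diag_pos.le (hdet.trans (ih hST.2)))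

/-- The covariance matrix of square-integrable random variables is positive semidefinite. -/
lemma posSemidef_covariance_of_memLp {ι Ω : Type*} [Fintype ι] [MeasurableSpace Ω]
    {μ : Measure Ω} [IsFiniteMeasure μ] {X : ι → Ω → ℝ} (hX : ∀ i, MemLp (X i) 2 μ) :
    (Matrix.of fun i j => cov[X i, X j; μ]).PosSemidef := by
  refine Matrix.PosSemidef.of_dotProduct_mulVec_nonneg
    (Matrix.IsHermitian.ext fun i j => covariance_comm _ _) fun a => ?_
  have hvar : 0 ≤ Var[fun ω => ∑ i, a i * X i ω; μ] := variance_nonneg _ _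
  rw [variance_fun_sum fun i => (hX i).const_mul (a i)] at hvar
  simp only [covariance_const_mul_left, covariance_const_mul_right] at hvar
  refine hvar.trans_eq ?_
  simp only [dotProduct, Matrix.mulVec, Matrix.of_apply, Finset.mul_sum, star_trivial]
  refine Finset.sum_congr rfl fun i _ => Finset.sum_congr rfl fun j _ => ?_
  ring

lemma IsGaussianVector.memLp {Ω : Type*} [MeasureSpace Ω] {n : ℕ} {X : Ω → Fin n → ℝ}
    (hX : IsGaussianVector X) (i : Fin n) : MemLp (fun ω => X ω i) 2 ℙ := by
  obtain ⟨m, v, h⟩ := hX (Pi.single i 1)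
  simp only [Pi.single_apply, ite_mul, one_mul, zero_mul, Finset.sum_ite_eq', Finset.mem_univ,
    if_true] at h
  have hmeas : AEMeasurable (fun ω => X ω i) ℙ :=
    AEMeasurable.of_map_ne_zero (h ▸ IsProbabilityMeasure.ne_zero _)
  have hid : MemLp id 2 (Measure.map (fun ω => X ω i) ℙ) := h ▸ memLp_id_gaussianReal 2
  exact hid.comp_of_map hmeas

theorem stmt17 {m : ℕ} {Ω : Type*} [MeasureSpace Ω]
    [IsProbabilityMeasure (ℙ : Measure Ω)]
    (W : Ω → ℝ) (Y : Ω → Fin m → ℝ)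
    (V : Ω → Fin (m + 1) → ℝ) (hV : ∀ ω, V ω = Fin.cons (W ω) (Y ω))
    (hGauss : IsGaussianVector V)
    (C : Fin (m + 1) → Fin (m + 1) → ℝ)
    (hC : ∀ i j, C i j = ∫ ω, V ω i * V ω j ∂ℙ -
      (∫ ω, V ω i ∂ℙ) * (∫ ω, V ω j ∂ℙ))
    (δ : ℝ) (hδ : 0 < δ)
    (hdet : δ < Matrix.det (Matrix.of fun i j : Fin m => C i.succ j.succ))
    (hmean : ∀ i, |∫ ω, V ω i ∂ℙ| < 1 / δ)
    (hcov : ∀ i j, |C i j| < 1 / δ) :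
    ∀ I : Finset (Fin m), I ≠ Finset.univ →
      ((m : ℝ) ^ m)⁻¹ * δ ^ (m + 1) ≤
        Matrix.det (Matrix.of fun i j : I => C i.1.succ j.1.succ) := by
  intro I hI
  set A : Matrix (Fin m) (Fin m) ℝ := Matrix.of fun i j => C i.succ j.succ with hAdef
  have hCcov : ∀ i j, C i j = cov[fun ω => V ω i, fun ω => V ω j; ℙ] := fun i j => by
    rw [hC, covariance_eq_sub (hGauss.memLp i) (hGauss.memLp j)]
    rfl
  have hAsemi : A.PosSemidef := by
    simpa only [hAdef, hCcov] using
      posSemidef_covariance_of_memLp fun i : Fin m => hGauss.memLp i.succ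
  have hA : A.PosDef := hAsemi.posDef_iff_det_ne_zero.2 (hδ.trans hdet).ne'
  have hbound : ∀ i, A i i ≤ δ⁻¹ := fun i =>
    (le_abs_self _).trans ((hcov _ _).le.trans_eq (one_div δ))
  have hminor : ∀ S : Finset (Fin m),
      δ ^ (Sᶜ.card + 1) ≤ (A.submatrix ((↑) : S → Fin m) (↑)).det := fun S => by
    have h := hA.det_submatrix_union_le hbound S Sᶜ disjoint_compl_left
    have huniv : (A.submatrix ((↑) : ↥(Sᶜ ∪ S) → Fin m) (↑)).det = A.det :=
      Matrix.det_submatrix_equiv_self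
        (Equiv.subtypeUnivEquiv fun i => by simp [em']) A
    rw [huniv, inv_pow] at h
    have h' := hdet.le.trans h
    rwa [← div_eq_mul_inv, le_div_iff₀ (by positivity), ← pow_succ'] at h'
  have hδ1 : δ ≤ 1 := by
    have h := hminor ∅
    rw [Matrix.det_isEmpty] at h
    exact (pow_le_one_iff_of_nonneg hδ.le (Nat.succ_ne_zero _)).1 h
  have hm : 1 ≤ (m : ℝ) := by
    obtain ⟨i, -⟩ : ∃ i, i ∉ I := by
      by_contra! h
      exact hI (Finset.eq_univ_iff_forall.2 h)
    exact_mod_cast i.pos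
  calc ((m : ℝ) ^ m)⁻¹ * δ ^ (m + 1) ≤ 1 * δ ^ (m + 1) := by
        gcongr
        exact inv_le_one_of_one_le₀ (one_le_pow₀ hm)
    _ = δ ^ (m + 1) := one_mul _
    _ ≤ δ ^ (Iᶜ.card + 1) :=
        pow_le_pow_of_le_one hδ.le hδ1 (by simpa using Iᶜ.card_le_univ)
    _ ≤ _ := hminor I
end
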